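/- Let R be the fusion ring of Rep(D₈) with dimension homomorphism d and differential δ, let H² = ker(δ on C²)/im(δ from C¹), and let n_D be the 2-cocycle with n_D(e_D,e_D) = 1 and all other basis values 0. Then the assignment sending the class of a 2-cocycle n to the pair ( (n(e_{(0,1)}, e_{(0,1)}) − n(e_{(0,0)}, e_{(0,0)})) mod 2 , (n(e_{(1,0)}, e_{(1,0)}) − n(e_{(0,0)}, e_{(0,0)})) mod 2 ) ∈ ℤ/2 × ℤ/2 is a well-defined surjective group homomorphism H² → ℤ/2 × ℤ/2 whose kernel is exactly the cyclic subgroup of order 4 generated by the class of n_D. In particular H² is an extension of ℤ/2 × ℤ/2 by ℤ/4. -/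

import Mathlib

noncomputable section

namespace RepD8Fusion

/-- Index of the basis of the fusion ring of `Rep(D₈)`: the four invertible simple
objects labelled by `ℤ/2 × ℤ/2` and the two-dimensional simple object `D`. -/
inductive Bas : Type
  | inv : ZMod 2 × ZMod 2 → Bas
  | D : Bas
  deriving DecidableEq

/-- The fusion ring of `Rep(D₈)` as a free ℤ-module on the five simple objects. -/
abbrev R : Type := Bas →₀ ℤ

/-- The basis element `e_a` for `a ∈ ℤ/2 × ℤ/2`. -/
def e (a : ZMod 2 × ZMod 2) : R := Finsupp.single (Bas.inv a) 1

/-- The basis element `e_D`. -/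
def eD : R := Finsupp.single Bas.D 1

/-- Multiplication on basis elements (the fusion rules of `Rep(D₈)`):
`e_a·e_b = e_{a+b}`, `e_a·e_D = e_D·e_a = e_D`, `e_D·e_D = Σ_a e_a`. -/
def mulB : Bas → Bas → R
  | Bas.inv a, Bas.inv b => e (a + b)
  | Bas.inv _, Bas.D => eD
  | Bas.D, Bas.inv _ => eD
  | Bas.D, Bas.D => ∑ a : ZMod 2 × ZMod 2, e a

/-- The ℤ-bilinear multiplication of the fusion ring, extending the fusion rules. -/
def mul : R →ₗ[ℤ] R →ₗ[ℤ] R :=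
  Finsupp.linearCombination ℤ (fun x => Finsupp.linearCombination ℤ (fun y => mulB x y))

/-- Dimensions of the simple objects: `d(e_a) = 1`, `d(e_D) = 2`. -/
def dB : Bas → ℤ
  | Bas.inv _ => 1
  | Bas.D => 2

/-- The dimension homomorphism `d : R → ℤ` (as a ℤ-linear map; it is the unique ring
homomorphism with `d(e_a) = 1` and `d(e_D) = 2`). -/
def dim : R →ₗ[ℤ] ℤ := Finsupp.linearCombination ℤ dB

end RepD8Fusion

namespace RepD8Fusion

/-- The differential `δ₂` on ℤ-bilinear 2-cochains, recorded as an additive group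
homomorphism into `ℤ`-valued functions of three variables:
`(δ₂ n)(r₁,r₂,r₃) = d(r₁)n(r₂,r₃) − n(r₁r₂,r₃) + n(r₁,r₂r₃) − n(r₁,r₂)d(r₃)`. -/
def delta2 : (R →ₗ[ℤ] R →ₗ[ℤ] ℤ) →+ (R → R → R → ℤ) where
  toFun n := fun r₁ r₂ r₃ =>
    dim r₁ * n r₂ r₃ - n (mul r₁ r₂) r₃ + n r₁ (mul r₂ r₃) - n r₁ r₂ * dim r₃
  map_zero' := by
    funext r₁ r₂ r₃; simp
  map_add' n m := by
    funext r₁ r₂ r₃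
    simp only [LinearMap.add_apply, Pi.add_apply]
    ring

/-- The differential `δ₁` from ℤ-linear 1-cochains to ℤ-bilinear 2-cochains:
`(δ₁ l)(r,s) = d(r)l(s) − l(rs) + l(r)d(s)`. -/
def delta1 : (R →ₗ[ℤ] ℤ) →+ (R →ₗ[ℤ] R →ₗ[ℤ] ℤ) where
  toFun l := LinearMap.mk₂ ℤ (fun r s => dim r * l s - l (mul r s) + l r * dim s)
    (by intro r₁ r₂ s; simp only [map_add, LinearMap.add_apply]; ring)
    (by intro c r s
        simp only [map_smul, LinearMap.smul_apply, smul_eq_mul]; ring)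
    (by intro r s₁ s₂; simp only [map_add, LinearMap.add_apply]; ring)
    (by intro c r s
        simp only [map_smul, LinearMap.smul_apply, smul_eq_mul]; ring)
  map_zero' := by
    refine LinearMap.ext fun r => LinearMap.ext fun s => ?_
    simp [LinearMap.mk₂_apply]
  map_add' l m := by
    refine LinearMap.ext fun r => LinearMap.ext fun s => ?_
    simp only [LinearMap.mk₂_apply, LinearMap.add_apply]
    ring

/-- The group of ℤ-bilinear 2-cocycles. -/
def Z2 : AddSubgroup (R →ₗ[ℤ] R →ₗ[ℤ] ℤ) := delta2.ker

/-- The group of ℤ-bilinear 2-coboundaries. -/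
def B2 : AddSubgroup (R →ₗ[ℤ] R →ₗ[ℤ] ℤ) := delta1.range

/-- The second cohomology group `H² = ker δ₂ / im δ₁` of the fusion ring of `Rep(D₈)`. -/
abbrev H2 : Type := ↥Z2 ⧸ (B2.addSubgroupOf Z2)

/-- The class in `H²` of a 2-cocycle. -/
def cls (n : R →ₗ[ℤ] R →ₗ[ℤ] ℤ) (hn : n ∈ Z2) : H2 :=
  QuotientAddGroup.mk (⟨n, hn⟩ : ↥Z2)

end RepD8Fusion

namespace RepD8Fusion

/-- The ℤ-bilinear 2-cochain `n_D` with `n_D(e_D, e_D) = 1` and value `0` on all other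
pairs of basis elements. -/
def nD : R →ₗ[ℤ] R →ₗ[ℤ] ℤ :=
  (LinearMap.mul ℤ ℤ).compl₁₂ (Finsupp.lapply Bas.D) (Finsupp.lapply Bas.D)

lemma mul_single (x y : Bas) :
    mul (Finsupp.single x 1) (Finsupp.single y 1) = mulB x y := by
  simp [mul]

lemma mul_e_e (a b : ZMod 2 × ZMod 2) : mul (e a) (e b) = e (a + b) := mul_single _ _

lemma mul_e_eD (a : ZMod 2 × ZMod 2) : mul (e a) eD = eD := mul_single _ _

lemma mul_eD_e (a : ZMod 2 × ZMod 2) : mul eD (e a) = eD := mul_single _ _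

lemma mul_eD_eD : mul eD eD = ∑ a : ZMod 2 × ZMod 2, e a := mul_single _ _

lemma dim_e (a : ZMod 2 × ZMod 2) : dim (e a) = 1 := by simp [dim, e, dB]

lemma dim_eD : dim eD = 2 := by simp [dim, eD, dB]

/-- Bilinear maps on the fusion ring that agree on pairs of simple objects are equal. -/
lemma bilin_ext {n m : R →ₗ[ℤ] R →ₗ[ℤ] ℤ} (hee : ∀ a b, n (e a) (e b) = m (e a) (e b))
    (heD : ∀ a, n (e a) eD = m (e a) eD) (hDe : ∀ a, n eD (e a) = m eD (e a))
    (hDD : n eD eD = m eD eD) : n = m := by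
  ext x y
  rcases x with a | _ <;> rcases y with b | _
  exacts [hee a b, heD a, hDe b, hDD]

lemma delta1_apply (l : R →ₗ[ℤ] ℤ) (r s : R) :
    delta1 l r s = dim r * l s - l (mul r s) + l r * dim s := rfl

lemma mem_Z2_iff {n : R →ₗ[ℤ] R →ₗ[ℤ] ℤ} :
    n ∈ Z2 ↔ ∀ r s t,
      dim r * n s t - n (mul r s) t + n r (mul s t) - n r s * dim t = 0 :=
  ⟨fun h r s t => congrFun (congrFun (congrFun (AddMonoidHom.mem_ker.1 h) r) s) t,
    fun h => AddMonoidHom.mem_ker.2 (funext fun r => funext fun s => funext (h r s))⟩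

lemma nD_apply (r s : R) : nD r s = r Bas.D * s Bas.D := rfl

/-- Evaluation at `(e_a, e_a)` minus evaluation at `(e_0, e_0)`, modulo `2`. -/
def diagMod (a : ZMod 2 × ZMod 2) : (R →ₗ[ℤ] R →ₗ[ℤ] ℤ) →+ ZMod 2 where
  toFun n := ((n (e a) (e a) - n (e 0) (e 0) : ℤ) : ZMod 2)
  map_zero' := by simp
  map_add' n m := by
    simp only [LinearMap.add_apply]
    push_cast
    ring

lemma diagMod_delta1 (a : ZMod 2 × ZMod 2) (l : R →ₗ[ℤ] ℤ) : diagMod a (delta1 l) = 0 := by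
  have ha : a + a = 0 := Prod.ext (CharTwo.add_self_eq_zero _) (CharTwo.add_self_eq_zero _)
  refine (ZMod.intCast_zmod_eq_zero_iff_dvd _ 2).2 ⟨l (e a) - l (e 0), ?_⟩
  simp only [delta1_apply, mul_e_e, dim_e, ha, add_zero]
  push_cast
  ring

/-- The homomorphism `H² → ℤ/2 × ℤ/2` induced by `diagMod` at `(0,1)` and `(1,0)`. -/
def diagH2 : H2 →+ ZMod 2 × ZMod 2 :=
  QuotientAddGroup.lift _ (((diagMod (0, 1)).prod (diagMod (1, 0))).comp Z2.subtype) <| by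
    rintro ⟨n, hn⟩ ⟨l, rfl⟩
    exact Prod.ext (diagMod_delta1 _ l) (diagMod_delta1 _ l)

lemma diagH2_cls (n : R →ₗ[ℤ] R →ₗ[ℤ] ℤ) (hn : n ∈ Z2) :
    diagH2 (cls n hn) = (diagMod (0, 1) n, diagMod (1, 0) n) := rfl

lemma cls_eq_zero_iff {n : R →ₗ[ℤ] R →ₗ[ℤ] ℤ} {hn : n ∈ Z2} :
    cls n hn = 0 ↔ ∃ l, delta1 l = n :=
  QuotientAddGroup.eq_zero_iff _

/-- For `(p, q) ≠ 0` and the character `χ` of the fusion ring with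
`χ(e_a) = (-1)^{p a₂ + q a₁}` and `χ(e_D) = 0`, the functional `(dim - χ) / 2`. -/
def halfChar (p q : ZMod 2) : R →ₗ[ℤ] ℤ :=
  Finsupp.linearCombination ℤ fun
    | Bas.inv a => ((p * a.2 + q * a.1).val : ℤ)
    | Bas.D => 1

lemma halfChar_e (p q : ZMod 2) (a : ZMod 2 × ZMod 2) :
    halfChar p q (e a) = ((p * a.2 + q * a.1).val : ℤ) := by
  simp [halfChar, e]

lemma halfChar_eD (p q : ZMod 2) : halfChar p q eD = 1 := by
  simp [halfChar, eD]

/-- The square `f ⊗ f` of `f = halfChar p q`. -/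
def halfCharSq (p q : ZMod 2) : R →ₗ[ℤ] R →ₗ[ℤ] ℤ :=
  (LinearMap.mul ℤ ℤ).compl₁₂ (halfChar p q) (halfChar p q)

lemma halfCharSq_apply (p q : ZMod 2) (r s : R) :
    halfCharSq p q r s = halfChar p q r * halfChar p q s := rfl

lemma delta1_halfChar {p q : ZMod 2} (hpq : (p, q) ≠ 0) :
    delta1 (halfChar p q) = (2 : ℤ) • halfCharSq p q := by
  apply bilin_ext <;>
    simp only [delta1_apply, LinearMap.smul_apply, halfCharSq_apply, mul_e_e, mul_e_eD, mul_eD_e,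
      mul_eD_eD, dim_e, dim_eD, map_sum, halfChar_e, halfChar_eD, smul_eq_mul]
  · clear hpq; revert p q; decide
  · intro a; ring
  · intro a; ring
  · revert p q; decide

lemma halfCharSq_mem_Z2 {p q : ZMod 2} (hpq : (p, q) ≠ 0) : halfCharSq p q ∈ Z2 := by
  have h (r s : R) := LinearMap.congr_fun₂ (delta1_halfChar hpq) r s
  simp only [delta1_apply, LinearMap.smul_apply, halfCharSq_apply, smul_eq_mul] at h
  refine mem_Z2_iff.2 fun r s t => ?_
  simp only [halfCharSq_apply]
  linear_combination halfChar p q t * h r s - halfChar p q r * h s t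

lemma diagH2_surjective : Function.Surjective diagH2 := by
  rintro ⟨p, q⟩
  by_cases hpq : (p, q) = 0
  · exact ⟨0, by rw [map_zero, hpq]⟩
  refine ⟨cls _ (halfCharSq_mem_Z2 hpq), ?_⟩
  simp only [diagH2_cls, diagMod, AddMonoidHom.coe_mk, ZeroHom.coe_mk, halfCharSq_apply,
    halfChar_e]
  clear hpq
  revert p q
  decide

/-- A cocycle on which `diagMod` vanishes at two generators takes even values on
`(e_a, e_D)`. -/
lemma even_apply_e_eD {n : R →ₗ[ℤ] R →ₗ[ℤ] ℤ} (hn : n ∈ Z2) (h₁ : diagMod (0, 1) n = 0)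
    (h₂ : diagMod (1, 0) n = 0) (a : ZMod 2 × ZMod 2) : 2 ∣ n (e a) eD := by
  have hab (a b : ZMod 2 × ZMod 2) :
      n (e b) eD - n (e (a + b)) eD + n (e a) eD - 2 * n (e a) (e b) = 0 := by
    have := mem_Z2_iff.1 hn (e a) (e b) eD
    simp only [mul_e_e, mul_e_eD, dim_e, dim_eD] at this
    linear_combination this
  have hdiag (a : ZMod 2 × ZMod 2) (h : diagMod a n = 0) : 2 ∣ n (e a) eD := by
    have hdvd : (2 : ℤ) ∣ n (e a) (e a) - n (e 0) (e 0) :=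
      (ZMod.intCast_zmod_eq_zero_iff_dvd _ 2).1 h
    have haa := hab a a
    rw [show a + a = 0 from Prod.ext (CharTwo.add_self_eq_zero _) (CharTwo.add_self_eq_zero _)] at haa
    have h00 := hab 0 0
    rw [add_zero] at h00
    omega
  have h01 := hdiag _ h₁
  have h10 := hdiag _ h₂
  have h11 := hab (0, 1) (1, 0)
  have h00 := hab 0 0
  rw [add_zero] at h00
  have hcases : a = 0 ∨ a = (0, 1) ∨ a = (1, 0) ∨ a = (0, 1) + (1, 0) := by
    revert a; decide
  rcases hcases with rfl | rfl | rfl | rfl <;> omega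

/-- A cocycle with even values on all `(e_a, e_D)` is cohomologous to a multiple of `n_D`. -/
lemma exists_delta1_eq_sub_smul_nD {n : R →ₗ[ℤ] R →ₗ[ℤ] ℤ} (hn : n ∈ Z2)
    (heven : ∀ a, 2 ∣ n (e a) eD) : ∃ (l : R →ₗ[ℤ] ℤ) (c : ℤ), delta1 l = n - c • nD := by
  choose f hf using heven
  let l : R →ₗ[ℤ] ℤ := Finsupp.linearCombination ℤ fun
    | Bas.inv a => f a
    | Bas.D => 0
  have hle (a : ZMod 2 × ZMod 2) : l (e a) = f a := by simp [l, e]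
  have hlD : l eD = 0 := by simp [l, eD]
  have heD (a : ZMod 2 × ZMod 2) : e a Bas.D = 0 := by simp [e]
  have hDD : eD Bas.D = 1 := by simp [eD]
  refine ⟨l, n eD eD + ∑ a, f a, bilin_ext ?_ ?_ ?_ ?_⟩ <;>
    simp only [delta1_apply, LinearMap.sub_apply, LinearMap.smul_apply, nD_apply, mul_e_e,
      mul_e_eD, mul_eD_e, mul_eD_eD, dim_e, dim_eD, map_sum, hle, hlD, heD, hDD, smul_eq_mul]
  · intro a b
    have := mem_Z2_iff.1 hn (e a) (e b) eD
    simp only [mul_e_e, mul_e_eD, dim_e, dim_eD, hf] at this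
    linarith
  · intro a
    linarith [hf a]
  · intro a
    have := mem_Z2_iff.1 hn eD (e a) eD
    simp only [mul_eD_e, mul_e_eD, dim_eD, hf] at this
    linarith
  · ring

lemma diagH2_ker (hnD : nD ∈ Z2) : diagH2.ker = AddSubgroup.zmultiples (cls nD hnD) := by
  apply le_antisymm
  · intro x hx
    obtain ⟨⟨n, hn⟩, rfl⟩ := QuotientAddGroup.mk_surjective x
    obtain ⟨h₁, h₂⟩ := Prod.ext_iff.1 (AddMonoidHom.mem_ker.1 hx)
    obtain ⟨l, c, hl⟩ := exists_delta1_eq_sub_smul_nD hn (even_apply_e_eD hn h₁ h₂)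
    refine AddSubgroup.mem_zmultiples_iff.2 ⟨c, (sub_eq_zero.1 ?_).symm⟩
    exact cls_eq_zero_iff (hn := sub_mem hn (zsmul_mem hnD c)).2 ⟨l, hl⟩
  · rw [AddSubgroup.zmultiples_le, AddMonoidHom.mem_ker, diagH2_cls]
    simp [diagMod, nD_apply, e]

lemma exists_delta1_eq_nsmul_nD_iff (m : ℕ) : (∃ l, delta1 l = m • nD) ↔ 4 ∣ m := by
  have heD (a : ZMod 2 × ZMod 2) : e a Bas.D = 0 := by simp [e]
  have hDD : eD Bas.D = 1 := by simp [eD]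
  constructor
  · rintro ⟨l, hl⟩
    have hle (a : ZMod 2 × ZMod 2) : l (e a) = 0 := by
      have := LinearMap.congr_fun₂ hl (e a) eD
      simp only [delta1_apply, LinearMap.smul_apply, nD_apply, mul_e_eD, dim_e, dim_eD, heD,
        zero_mul, smul_zero] at this
      linarith
    have := LinearMap.congr_fun₂ hl eD eD
    simp only [delta1_apply, LinearMap.smul_apply, nD_apply, mul_eD_eD, dim_eD, hDD, map_sum,
      hle, Finset.sum_const_zero, nsmul_eq_mul] at this
    omega
  · rintro ⟨k, rfl⟩
    refine ⟨k • Finsupp.lapply Bas.D, bilin_ext ?_ ?_ ?_ ?_⟩ <;>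
      simp only [delta1_apply, LinearMap.smul_apply, Finsupp.lapply_apply, nD_apply, mul_e_e,
        mul_e_eD, mul_eD_e, mul_eD_eD, dim_e, dim_eD, Finsupp.finsetSum_apply, heD, hDD,
        Finset.sum_const_zero, nsmul_eq_mul, Nat.cast_mul, Nat.cast_ofNat] <;>
      intros <;> ring

lemma addOrderOf_cls_nD (hnD : nD ∈ Z2) : addOrderOf (cls nD hnD) = 4 := by
  refine Nat.dvd_right_iff_eq.1 fun m => ?_
  rw [addOrderOf_dvd_iff_nsmul_eq_zero, ← exists_delta1_eq_nsmul_nD_iff]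
  exact cls_eq_zero_iff (hn := nsmul_mem hnD m)

/-- The assignment sending the class of a 2-cocycle `n` to
`((n(e_{(0,1)},e_{(0,1)}) − n(e_{(0,0)},e_{(0,0)})) mod 2,
  (n(e_{(1,0)},e_{(1,0)}) − n(e_{(0,0)},e_{(0,0)})) mod 2) ∈ ℤ/2 × ℤ/2`
is a well-defined surjective group homomorphism `H² → ℤ/2 × ℤ/2` whose kernel is
exactly the cyclic subgroup of order 4 generated by the class of `n_D`.  (In
particular `H²` is an extension of `ℤ/2 × ℤ/2` by `ℤ/4`.) -/
theorem H2_surjection_onto_Z2xZ2 (hnD : nD ∈ Z2) :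
    ∃ φ : H2 →+ ZMod 2 × ZMod 2,
      (∀ (n : R →ₗ[ℤ] R →ₗ[ℤ] ℤ) (hn : n ∈ Z2),
          φ (cls n hn) =
            (((n (e (0, 1)) (e (0, 1)) - n (e (0, 0)) (e (0, 0)) : ℤ) : ZMod 2),
             ((n (e (1, 0)) (e (1, 0)) - n (e (0, 0)) (e (0, 0)) : ℤ) : ZMod 2))) ∧
      Function.Surjective φ ∧
      φ.ker = AddSubgroup.zmultiples (cls nD hnD) ∧
      addOrderOf (cls nD hnD) = 4 := by
  exact ⟨diagH2, fun _ _ => rfl, diagH2_surjective, diagH2_ker hnD, addOrderOf_cls_nD hnD⟩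

end RepD8Fusion
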